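/- arXiv:1205.0533 — 5 statements merged into one kernel-verified Lean document; each statement's English description precedes it below -/
import Mathlib

section
/- Let P be a finite set and ν : P × P → ℤ satisfy Σ_{q ∈ P} ν(r,q)·ν(q,p) = 0 for all p, r ∈ P, and fix two distinct elements p̄, q̄ ∈ P with ν(q̄,p̄) = 1. Define P' := P ∖ {p̄, q̄} and ν'(q,p) := ν(q,p) − ν(q,p̄)·ν(q̄,p) for p, q ∈ P'. Then Σ_{q ∈ P'} ν'(r,q)·ν'(q,p) = 0 for all p, r ∈ P'; equivalently, the induced differential ∂' on the free ℤ-module with basis P' satisfies ∂' ∘ ∂' = 0. -/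
/-- **Floer's reduction lemma, Step 1.**
Let `P` be a finite set and `ν : P × P → ℤ` satisfy `Σ_{q ∈ P} ν(r,q)·ν(q,p) = 0` for all
`p, r ∈ P`, and fix two distinct elements `p̄, q̄ ∈ P` with `ν(q̄,p̄) = 1`.
Define `P' := P ∖ {p̄, q̄}` and `ν'(q,p) := ν(q,p) − ν(q,p̄)·ν(q̄,p)` for `p, q ∈ P'`.
Then `Σ_{q ∈ P'} ν'(r,q)·ν'(q,p) = 0` for all `p, r ∈ P'`; equivalently the induced
differential `∂'` on the free ℤ-module with basis `P'` satisfies `∂' ∘ ∂' = 0`. -/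
theorem floer_reduction_dsquare_zero {P : Type*} [Fintype P] [DecidableEq P]
    (ν : P → P → ℤ)
    (hν : ∀ r p : P, ∑ q : P, ν r q * ν q p = 0)
    (pbar qbar : P) (hne : pbar ≠ qbar) (hone : ν qbar pbar = 1) :
    ∀ r p : {x : P // x ≠ pbar ∧ x ≠ qbar},
      ∑ q : {x : P // x ≠ pbar ∧ x ≠ qbar},
        (ν r.1 q.1 - ν r.1 pbar * ν qbar q.1) * (ν q.1 p.1 - ν q.1 pbar * ν qbar p.1) = 0 := by
  intro r p
  let f : P → ℤ := fun q =>
    (ν r.1 q - ν r.1 pbar * ν qbar q) * (ν q p.1 - ν q pbar * ν qbar p.1)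
  have full : ∑ q : P, f q = 0 := by
    calc ∑ q : P, f q
        = ∑ q : P, ν r.1 q * ν q p.1 - (∑ q : P, ν r.1 q * ν q pbar) * ν qbar p.1
          - ν r.1 pbar * ∑ q : P, ν qbar q * ν q p.1
          + ν r.1 pbar * (∑ q : P, ν qbar q * ν q pbar) * ν qbar p.1 := by
          simp only [Finset.mul_sum, Finset.sum_mul, ← Finset.sum_sub_distrib,
            ← Finset.sum_add_distrib]
          exact Finset.sum_congr rfl fun q _ => by simp only [f]; ring
      _ = 0 := by simp only [hν]; ring
  have restrict : ∑ q : P with q ≠ pbar ∧ q ≠ qbar, f q = ∑ q : P, f q := by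
    refine Finset.sum_filter_of_ne fun q _ hq => ⟨?_, ?_⟩
    · rintro rfl
      exact hq (by simp [f, hone])
    · rintro rfl
      exact hq (by simp [f, hone])
  exact (Finset.sum_subtype _ (by simp) f).symm.trans (restrict.trans full)
end

section
/- Let P be a finite set, ν : P × P → ℤ with Σ_{q ∈ P} ν(r,q)·ν(q,p) = 0 for all p, r ∈ P, and p̄ ≠ q̄ in P with ν(q̄,p̄) = 1; let (C,∂) and (C',∂') be the associated differential ℤ-modules, where P' = P ∖ {p̄,q̄} and ν'(q,p) = ν(q,p) − ν(q,p̄)·ν(q̄,p). Then ∂ ∘ ∂ = 0 and ∂' ∘ ∂' = 0, and the homology ℤ-modules are isomorphic: ker ∂' / im ∂' ≅ ker ∂ / im ∂. -/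
/-- The boundary operator `∂ = ∂^ν` on the free ℤ-module `C(P) = (P → ℤ)` determined on
basis elements by `∂q = Σ_{p ∈ P} ν(q,p)·p`; on a function `f` it is given by
`(∂f)(p) = Σ_{q ∈ P} ν(q,p)·f(q)`. -/
noncomputable def bdryOp {P : Type*} [Fintype P] (ν : P → P → ℤ) :
    (P → ℤ) →ₗ[ℤ] (P → ℤ) where
  toFun f := fun p => ∑ q : P, ν q p * f q
  map_add' f g := by
    funext p
    simp only [Pi.add_apply, mul_add, Finset.sum_add_distrib]
  map_smul' c f := by
    funext p
    simp only [Pi.smul_apply, smul_eq_mul, RingHom.id_apply, Finset.mul_sum]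
    exact Finset.sum_congr rfl fun q _ => by ring

/-- The homology `ker ∂ / im ∂` of the differential ℤ-module `(C(P), ∂^ν)`. -/
abbrev homologyOf {P : Type*} [Fintype P] (ν : P → P → ℤ) :=
  LinearMap.ker (bdryOp ν) ⧸
    (LinearMap.range (bdryOp ν)).comap (LinearMap.ker (bdryOp ν)).subtype

/-- Homotopy inverse chain maps between differential modules induce an isomorphism on homology;
here the composite on the smaller module is the identity on the nose. -/
theorem nonempty_homology_equiv_of_homotopy {M N : Type*} [AddCommGroup M] [AddCommGroup N]
    (d : M →ₗ[ℤ] M) (d' : N →ₗ[ℤ] N) (i : N →ₗ[ℤ] M) (r : M →ₗ[ℤ] N) (h : M → M)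
    (hi : ∀ x, d (i x) = i (d' x)) (hr : ∀ x, d' (r x) = r (d x))
    (hri : ∀ x, r (i x) = x) (hh0 : h 0 = 0) (hh : ∀ x, x - i (r x) = d (h x) + h (d x)) :
    Nonempty ((LinearMap.ker d' ⧸ (LinearMap.range d').comap (LinearMap.ker d').subtype) ≃ₗ[ℤ]
      (LinearMap.ker d ⧸ (LinearMap.range d).comap (LinearMap.ker d).subtype)) := by
  have hik : ∀ x ∈ LinearMap.ker d', i x ∈ LinearMap.ker d := by
    intro x hx
    rw [LinearMap.mem_ker] at hx ⊢
    rw [hi, hx, map_zero]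
  have hrk : ∀ x ∈ LinearMap.ker d, r x ∈ LinearMap.ker d' := by
    intro x hx
    rw [LinearMap.mem_ker] at hx ⊢
    rw [hr, hx, map_zero]
  refine ⟨LinearEquiv.ofLinearMap
    (Submodule.mapQ _ _ (i.restrict hik) ?_) (Submodule.mapQ _ _ (r.restrict hrk) ?_) ?_ ?_⟩
  · rintro x ⟨y, hy⟩
    exact ⟨i y, by rw [hi, hy]; rfl⟩
  · rintro x ⟨y, hy⟩
    exact ⟨r y, by rw [hr, hy]; rfl⟩
  · refine Submodule.linearMap_qext _ (LinearMap.ext fun x => ?_)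
    refine ((Submodule.Quotient.eq _).2 ?_).symm
    refine ⟨h x, ?_⟩
    have hx : d x = 0 := x.2
    have := hh x
    rw [hx, hh0, add_zero] at this
    exact this.symm
  · refine Submodule.linearMap_qext _ (LinearMap.ext fun x => ?_)
    exact congrArg (Submodule.Quotient.mk) (Subtype.ext (hri x))

theorem bdryOp_apply {P : Type*} [Fintype P] (ν : P → P → ℤ) (f : P → ℤ) (p : P) :
    bdryOp ν f p = ∑ q : P, ν q p * f q := rfl

theorem bdryOp_bdryOp {P : Type*} [Fintype P] (ν : P → P → ℤ)
    (hν : ∀ r p : P, ∑ q : P, ν r q * ν q p = 0) (f : P → ℤ) :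
    bdryOp ν (bdryOp ν f) = 0 := by
  funext p
  simp only [bdryOp_apply, Finset.mul_sum, Pi.zero_apply]
  rw [Finset.sum_comm]
  refine Finset.sum_eq_zero fun r _ => ?_
  have : ∑ q : P, ν q p * (ν r q * f r) = (∑ q : P, ν r q * ν q p) * f r := by
    rw [Finset.sum_mul]
    exact Finset.sum_congr rfl fun q _ => by ring
  rw [this, hν, zero_mul]

theorem sum_eq_add_add_sum_subtype_ne {P : Type*} [Fintype P] [DecidableEq P] {a b : P}
    (hab : a ≠ b) (F : P → ℤ) :
    ∑ q : P, F q = F a + F b + ∑ q : {x : P // x ≠ a ∧ x ≠ b}, F q.1 := by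
  have h : ∑ q : {x : P // x ≠ a ∧ x ≠ b}, F q.1 =
      ∑ q ∈ (Finset.univ.erase a).erase b, F q :=
    (Finset.sum_subtype _ (fun x => by simp [and_comm]) F).symm
  rw [h, add_assoc, Finset.add_sum_erase _ _ (by simp [hab.symm]),
    Finset.add_sum_erase _ _ (Finset.mem_univ a)]

/-- The chain map `C(P ∖ {a, b}) → C(P)` sending `q` to `q - ν(q,a)·b`. -/
noncomputable def reductionIncl {P : Type*} [Fintype P] [DecidableEq P] (ν : P → P → ℤ)
    (a b : P) : ({x : P // x ≠ a ∧ x ≠ b} → ℤ) →ₗ[ℤ] (P → ℤ) where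
  toFun f p := if hp : p ≠ a ∧ p ≠ b then f ⟨p, hp⟩ else
    if p = a then 0 else -∑ q : {x : P // x ≠ a ∧ x ≠ b}, ν q.1 a * f q
  map_add' f g := by
    funext p
    simp only [Pi.add_apply, mul_add, Finset.sum_add_distrib]
    split_ifs <;> ring
  map_smul' c f := by
    funext p
    simp only [Pi.smul_apply, smul_eq_mul, RingHom.id_apply, mul_left_comm _ c, ← Finset.mul_sum]
    split_ifs <;> ring

/-- The chain map `C(P) → C(P ∖ {a, b})` sending `b` to `0`, `a` to `-Σ_p ν(b,p)·p`, and fixing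
the other basis elements. -/
def reductionProj {P : Type*} (ν : P → P → ℤ) (a b : P) :
    (P → ℤ) →ₗ[ℤ] ({x : P // x ≠ a ∧ x ≠ b} → ℤ) where
  toFun g p := g p.1 - g a * ν b p.1
  map_add' f g := by
    funext p
    simp only [Pi.add_apply]
    ring
  map_smul' c f := by
    funext p
    simp only [Pi.smul_apply, smul_eq_mul, RingHom.id_apply]
    ring

theorem reductionProj_apply {P : Type*} (ν : P → P → ℤ) (a b : P) (g : P → ℤ)
    (p : {x : P // x ≠ a ∧ x ≠ b}) : reductionProj ν a b g p = g p.1 - g a * ν b p.1 := rfl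

section

variable {P : Type*} [Fintype P] [DecidableEq P] (ν : P → P → ℤ) {a b : P}

theorem reductionIncl_apply_left (f : {x : P // x ≠ a ∧ x ≠ b} → ℤ) :
    reductionIncl ν a b f a = 0 := by
  simp [reductionIncl]

theorem reductionIncl_apply_right (hab : a ≠ b) (f : {x : P // x ≠ a ∧ x ≠ b} → ℤ) :
    reductionIncl ν a b f b = -∑ q : {x : P // x ≠ a ∧ x ≠ b}, ν q.1 a * f q := by
  simp [reductionIncl, hab.symm]

theorem reductionIncl_apply_coe (f : {x : P // x ≠ a ∧ x ≠ b} → ℤ)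
    (p : {x : P // x ≠ a ∧ x ≠ b}) : reductionIncl ν a b f p.1 = f p :=
  dif_pos p.2

theorem reductionProj_reductionIncl (f : {x : P // x ≠ a ∧ x ≠ b} → ℤ) :
    reductionProj ν a b (reductionIncl ν a b f) = f := by
  funext p
  rw [reductionProj_apply, reductionIncl_apply_coe, reductionIncl_apply_left, zero_mul, sub_zero]

theorem bdryOp_reductionIncl (hν : ∀ r p : P, ∑ q : P, ν r q * ν q p = 0) (hab : a ≠ b)
    (hone : ν b a = 1) (f : {x : P // x ≠ a ∧ x ≠ b} → ℤ) :
    bdryOp ν (reductionIncl ν a b f) = reductionIncl ν a b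
      (bdryOp (fun q p : {x : P // x ≠ a ∧ x ≠ b} => ν q.1 p.1 - ν q.1 a * ν b p.1) f) := by
  have hval : ∀ p, bdryOp ν (reductionIncl ν a b f) p =
      ∑ q : {x : P // x ≠ a ∧ x ≠ b}, (ν q.1 p - ν q.1 a * ν b p) * f q := by
    intro p
    rw [bdryOp_apply, sum_eq_add_add_sum_subtype_ne hab, reductionIncl_apply_left,
      reductionIncl_apply_right ν hab]
    simp only [reductionIncl_apply_coe, sub_mul, Finset.sum_sub_distrib]
    rw [mul_zero, zero_add, mul_neg, Finset.mul_sum, neg_add_eq_sub]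
    congr 1
    exact Finset.sum_congr rfl fun q _ => by ring
  have ha : bdryOp ν (reductionIncl ν a b f) a = 0 := by
    rw [hval]
    exact Finset.sum_eq_zero fun q _ => by rw [hone]; ring
  have hc : ∀ p : {x : P // x ≠ a ∧ x ≠ b}, bdryOp ν (reductionIncl ν a b f) p.1 =
      bdryOp (fun q p : {x : P // x ≠ a ∧ x ≠ b} => ν q.1 p.1 - ν q.1 a * ν b p.1) f p :=
    fun p => hval p.1
  funext p
  by_cases hp : p ≠ a ∧ p ≠ b
  · exact (hc ⟨p, hp⟩).trans (reductionIncl_apply_coe ν _ ⟨p, hp⟩).symm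
  by_cases hpa : p = a
  · rw [hpa, ha, reductionIncl_apply_left]
  obtain rfl : p = b := by tauto
  rw [reductionIncl_apply_right ν hab]
  have hsq := congrFun (bdryOp_bdryOp ν hν (reductionIncl ν a p f)) a
  rw [bdryOp_apply, sum_eq_add_add_sum_subtype_ne hab, ha, hone] at hsq
  simp only [hc, Pi.zero_apply] at hsq
  linarith

theorem bdryOp_reductionProj (hν : ∀ r p : P, ∑ q : P, ν r q * ν q p = 0) (hab : a ≠ b)
    (hone : ν b a = 1) (g : P → ℤ) :
    bdryOp (fun q p : {x : P // x ≠ a ∧ x ≠ b} => ν q.1 p.1 - ν q.1 a * ν b p.1)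
      (reductionProj ν a b g) = reductionProj ν a b (bdryOp ν g) := by
  funext p
  have hsum := sum_eq_add_add_sum_subtype_ne hab
    (fun q => (ν q p.1 - ν q a * ν b p.1) * (g q - g a * ν b q))
  have hexp : ∑ q : P, (ν q p.1 - ν q a * ν b p.1) * (g q - g a * ν b q) =
      ∑ q : P, ν q p.1 * g q - (∑ q : P, ν q a * g q) * ν b p.1
        - g a * ∑ q : P, ν b q * ν q p.1 + g a * ν b p.1 * ∑ q : P, ν b q * ν q a := by
    simp only [Finset.sum_mul, Finset.mul_sum, ← Finset.sum_sub_distrib, ← Finset.sum_add_distrib]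
    exact Finset.sum_congr rfl fun q _ => by ring
  rw [hexp, hν, hν, hone] at hsum
  simp only [reductionProj_apply, bdryOp_apply]
  linarith

theorem sub_reductionIncl_reductionProj (hν : ∀ r p : P, ∑ q : P, ν r q * ν q p = 0)
    (hab : a ≠ b) (hone : ν b a = 1) (g : P → ℤ) :
    g - reductionIncl ν a b (reductionProj ν a b g) =
      bdryOp ν (Pi.single b (g a)) + Pi.single b (bdryOp ν g a) := by
  have hs : ∀ p, bdryOp ν (Pi.single b (g a)) p = ν b p * g a := by
    intro p
    simp [bdryOp_apply, Pi.single_apply]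
  funext p
  rw [Pi.sub_apply, Pi.add_apply, hs]
  by_cases hp : p ≠ a ∧ p ≠ b
  · rw [reductionIncl_apply_coe ν _ ⟨p, hp⟩, reductionProj_apply, Pi.single_eq_of_ne hp.2]
    ring
  by_cases hpa : p = a
  · rw [hpa, reductionIncl_apply_left, Pi.single_eq_of_ne hab, hone]
    ring
  obtain rfl : p = b := by tauto
  have hsum := sum_eq_add_add_sum_subtype_ne hab (fun q => ν q a * (g q - g a * ν p q))
  have hexp : ∑ q : P, ν q a * (g q - g a * ν p q) =
      ∑ q : P, ν q a * g q - g a * ∑ q : P, ν p q * ν q a := by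
    simp only [Finset.mul_sum, ← Finset.sum_sub_distrib]
    exact Finset.sum_congr rfl fun q _ => by ring
  rw [hexp, hν, hone] at hsum
  rw [reductionIncl_apply_right ν hab, Pi.single_eq_same, bdryOp_apply]
  simp only [reductionProj_apply]
  linarith

end

/-- **Floer's reduction lemma.**
Let `P` be a finite set, `ν : P × P → ℤ` with `Σ_{q ∈ P} ν(r,q)·ν(q,p) = 0` for all `p, r`,
and `p̄ ≠ q̄` in `P` with `ν(q̄,p̄) = 1`; let `(C,∂)` and `(C',∂')` be the associated
differential ℤ-modules, where `P' = P ∖ {p̄,q̄}` and `ν'(q,p) = ν(q,p) − ν(q,p̄)·ν(q̄,p)`.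
Then `∂ ∘ ∂ = 0` and `∂' ∘ ∂' = 0`, and the homology ℤ-modules are isomorphic:
`ker ∂' / im ∂' ≅ ker ∂ / im ∂`. -/
theorem floer_reduction_homology_iso {P : Type*} [Fintype P] [DecidableEq P]
    (ν : P → P → ℤ)
    (hν : ∀ r p : P, ∑ q : P, ν r q * ν q p = 0)
    (pbar qbar : P) (hne : pbar ≠ qbar) (hone : ν qbar pbar = 1) :
    bdryOp ν ∘ₗ bdryOp ν = 0 ∧
    bdryOp (fun q p : {x : P // x ≠ pbar ∧ x ≠ qbar} =>
        ν q.1 p.1 - ν q.1 pbar * ν qbar p.1) ∘ₗ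
      bdryOp (fun q p : {x : P // x ≠ pbar ∧ x ≠ qbar} =>
        ν q.1 p.1 - ν q.1 pbar * ν qbar p.1) = 0 ∧
    Nonempty
      ((homologyOf (fun q p : {x : P // x ≠ pbar ∧ x ≠ qbar} =>
          ν q.1 p.1 - ν q.1 pbar * ν qbar p.1)) ≃ₗ[ℤ] homologyOf ν) := by
  refine ⟨LinearMap.ext fun f => bdryOp_bdryOp ν hν f, LinearMap.ext fun f => ?_,
    nonempty_homology_equiv_of_homotopy _ _ (reductionIncl ν pbar qbar)
      (reductionProj ν pbar qbar) (fun g => Pi.single qbar (g pbar))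
      (bdryOp_reductionIncl ν hν hne hone) (bdryOp_reductionProj ν hν hne hone)
      (reductionProj_reductionIncl ν) (by simp)
      (sub_reductionIncl_reductionProj ν hν hne hone)⟩
  rw [LinearMap.comp_apply, LinearMap.zero_apply]
  refine (Function.LeftInverse.injective (reductionProj_reductionIncl ν)) ?_
  rw [← bdryOp_reductionIncl ν hν hne hone, ← bdryOp_reductionIncl ν hν hne hone,
    bdryOp_bdryOp ν hν, map_zero]
end

section
/- In the setting of Floer's reduction lemma, the ℤ-linear map Φ : C' → C determined on basis elements q ∈ P' by Φq := q − ν(q,p̄)·q̄ is a chain map: Φ ∘ ∂' = ∂ ∘ Φ. -/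
/-- The boundary operator `∂ = ∂^ν` of the free ℤ-module `C(P) = (P → ℤ)`, determined on
basis elements by `∂q = Σ_{p ∈ P} ν(q,p)·p`; on a function `f` it is given by
`(∂f)(p) = Σ_{q ∈ P} ν(q,p)·f(q)`. -/
def bdryFun {P : Type*} [Fintype P] (ν : P → P → ℤ) (f : P → ℤ) : P → ℤ :=
  fun p => ∑ q : P, ν q p * f q

/-- The ℤ-linear map `Φ : C' → C` determined on basis elements `q ∈ P'` by
`Φq := q − ν(q,p̄)·q̄`: the coefficient of `Φf` at a basis element `x ∈ P'` is `f(x)`,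
at `q̄` it is `−Σ_{q ∈ P'} ν(q,p̄)·f(q)`, and at `p̄` it is `0`. -/
def PhiFun {P : Type*} [Fintype P] [DecidableEq P] (ν : P → P → ℤ) (pbar qbar : P)
    (f : {x : P // x ≠ pbar ∧ x ≠ qbar} → ℤ) : P → ℤ :=
  fun x =>
    (if h : x ≠ pbar ∧ x ≠ qbar then f ⟨x, h⟩ else 0) -
      (if x = qbar then ∑ q : {x : P // x ≠ pbar ∧ x ≠ qbar}, ν q.1 pbar * f q else 0)

theorem sum_eq_sum_subtype_ne_ne_add {P M : Type*} [Fintype P] [DecidableEq P] [AddCommMonoid M]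
    {a b : P} (hab : a ≠ b) (g : P → M) :
    ∑ x, g x = ∑ x : {x : P // x ≠ a ∧ x ≠ b}, g x.1 + (g a + g b) := by
  rw [← Fintype.sum_subtype_add_sum_subtype (fun x => x ≠ a ∧ x ≠ b) g]
  congr 1
  rw [← Finset.sum_pair hab]
  refine (Finset.sum_subtype ({a, b} : Finset P) (fun x => ?_) g).symm
  simp only [Finset.mem_insert, Finset.mem_singleton]
  tauto

theorem bdryFun_bdryFun {P : Type*} [Fintype P] {ν : P → P → ℤ}
    (hν : ∀ r p : P, ∑ q : P, ν r q * ν q p = 0) (f : P → ℤ) (p : P) :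
    bdryFun ν (bdryFun ν f) p = 0 := by
  simp only [bdryFun, Finset.mul_sum]
  rw [Finset.sum_comm]
  refine Finset.sum_eq_zero fun r _ => ?_
  rw [← zero_mul (f r), ← hν r p, Finset.sum_mul]
  exact Finset.sum_congr rfl fun q _ => by ring

theorem bdryFun_PhiFun {P : Type*} [Fintype P] [DecidableEq P] (ν : P → P → ℤ)
    {pbar qbar : P} (hne : pbar ≠ qbar) (f : {x : P // x ≠ pbar ∧ x ≠ qbar} → ℤ) (x : P) :
    bdryFun ν (PhiFun ν pbar qbar f) x =
      ∑ q : {x : P // x ≠ pbar ∧ x ≠ qbar}, (ν q.1 x - ν q.1 pbar * ν qbar x) * f q := by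
  have hP : ∀ q : {x : P // x ≠ pbar ∧ x ≠ qbar}, PhiFun ν pbar qbar f q.1 = f q := fun q => by
    simp [PhiFun, q.2.1, q.2.2]
  have hp : PhiFun ν pbar qbar f pbar = 0 := by simp [PhiFun, hne]
  have hq : PhiFun ν pbar qbar f qbar =
      -∑ q : {x : P // x ≠ pbar ∧ x ≠ qbar}, ν q.1 pbar * f q := by simp [PhiFun]
  rw [bdryFun, sum_eq_sum_subtype_ne_ne_add hne, hp, hq]
  simp only [hP, mul_zero, zero_add, mul_neg]
  rw [← sub_eq_add_neg, Finset.mul_sum, ← Finset.sum_sub_distrib]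
  exact Finset.sum_congr rfl fun q _ => by ring

/-- **Floer's reduction lemma, Step 2.**  In the setting of Floer's reduction lemma, the
ℤ-linear map `Φ : C' → C` determined on basis elements `q ∈ P'` by `Φq := q − ν(q,p̄)·q̄`
is a chain map:  `Φ ∘ ∂' = ∂ ∘ Φ`. -/
theorem floer_reduction_Phi_chain_map {P : Type*} [Fintype P] [DecidableEq P]
    (ν : P → P → ℤ)
    (hν : ∀ r p : P, ∑ q : P, ν r q * ν q p = 0)
    (pbar qbar : P) (hne : pbar ≠ qbar) (hone : ν qbar pbar = 1) :
    ∀ f : {x : P // x ≠ pbar ∧ x ≠ qbar} → ℤ,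
      PhiFun ν pbar qbar
          (bdryFun (fun q p : {x : P // x ≠ pbar ∧ x ≠ qbar} =>
            ν q.1 p.1 - ν q.1 pbar * ν qbar p.1) f) =
        bdryFun ν (PhiFun ν pbar qbar f) := by
  intro f
  have hD := bdryFun_PhiFun ν hne f
  funext x
  by_cases hx : x ≠ pbar ∧ x ≠ qbar
  · rw [hD]
    simp [PhiFun, bdryFun, hx.1, hx.2]
  have hp : bdryFun ν (PhiFun ν pbar qbar f) pbar = 0 := by simp [hD, hone]
  by_cases hxp : x = pbar
  · rw [hxp, hp]
    simp [PhiFun, hne]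
  obtain rfl : x = qbar := by tauto
  have h := bdryFun_bdryFun hν (PhiFun ν pbar x f) pbar
  rw [bdryFun, sum_eq_sum_subtype_ne_ne_add hne, hp, hone, mul_zero, zero_add, one_mul] at h
  rw [eq_neg_of_add_eq_zero_right h]
  simp only [hD]
  simp [PhiFun, bdryFun]
end

section
/- In the setting of Floer's reduction lemma, the ℤ-linear map Ψ : C → C' determined on basis elements by Ψq := q for q ∈ P', Ψq̄ := 0, and Ψp̄ := −Σ_{p ∈ P'} ν(q̄,p)·p is a chain map: ∂' ∘ Ψ = Ψ ∘ ∂. -/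
/-- The ℤ-linear map `Ψ : C → C'` determined on basis elements by `Ψq := q` for `q ∈ P'`,
`Ψq̄ := 0`, and `Ψp̄ := −Σ_{p ∈ P'} ν(q̄,p)·p`: the coefficient of `Ψf` at a basis
element `p ∈ P'` is `f(p) − f(p̄)·ν(q̄,p)`. -/
def PsiFun {P : Type*} (ν : P → P → ℤ) (pbar qbar : P)
    (f : P → ℤ) : {x : P // x ≠ pbar ∧ x ≠ qbar} → ℤ :=
  fun p => f p.1 - f pbar * ν qbar p.1

/-- **Floer's reduction lemma, Step 3.**  In the setting of Floer's reduction lemma, the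
ℤ-linear map `Ψ : C → C'` determined on basis elements by `Ψq := q` for `q ∈ P'`,
`Ψq̄ := 0`, and `Ψp̄ := −Σ_{p ∈ P'} ν(q̄,p)·p` is a chain map:  `∂' ∘ Ψ = Ψ ∘ ∂`. -/
theorem floer_reduction_Psi_chain_map {P : Type*} [Fintype P] [DecidableEq P]
    (ν : P → P → ℤ)
    (hν : ∀ r p : P, ∑ q : P, ν r q * ν q p = 0)
    (pbar qbar : P) (hne : pbar ≠ qbar) (hone : ν qbar pbar = 1) :
    ∀ f : P → ℤ,
      bdryFun (fun q p : {x : P // x ≠ pbar ∧ x ≠ qbar} =>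
          ν q.1 p.1 - ν q.1 pbar * ν qbar p.1) (PsiFun ν pbar qbar f) =
        PsiFun ν pbar qbar (bdryFun ν f) := by
  intro f
  funext p
  simp only [bdryFun, PsiFun]
  let g : P → ℤ := fun q =>
    (ν q p.1 - ν q pbar * ν qbar p.1) * (f q - f pbar * ν qbar q)
  have hg : ∀ q, g q ≠ 0 → q ≠ pbar ∧ q ≠ qbar := by
    refine fun q hq => ⟨?_, ?_⟩ <;> rintro rfl <;> simp [g, hone] at hq
  have hsub : ∑ q : {x : P // x ≠ pbar ∧ x ≠ qbar}, g q.1 = ∑ q, g q := by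
    rw [← Finset.sum_subtype (Finset.univ.filter fun x => x ≠ pbar ∧ x ≠ qbar) (by simp) g]
    exact Finset.sum_filter_of_ne fun q _ => hg q
  have hexp : ∀ q, g q = ν q p.1 * f q - ν q pbar * f q * ν qbar p.1
      - f pbar * (ν qbar q * ν q p.1)
      + f pbar * ν qbar p.1 * (ν qbar q * ν q pbar) := fun q => by
    simp only [g]
    ring
  refine hsub.trans ?_
  simp only [hexp, Finset.sum_add_distrib, Finset.sum_sub_distrib, ← Finset.mul_sum,
    ← Finset.sum_mul, hν]
  ring
end

section
/- Let (P, ≼) be a finite partially ordered set and (p̄, q̄) an adjacent pair in P. Then the relation ≼' defined on P' := P ∖ {p̄, q̄} by p ≼' q iff (p ≼ q) or (p̄ ≼ q and p ≼ q̄) is a partial order on P' (reflexive, antisymmetric and transitive). -/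
/-- The induced relation `≼'` on `P' := P ∖ {p̄, q̄}`:
`p ≼' q` iff `p ≼ q`, or `p̄ ≼ q` and `p ≼ q̄`. -/
def inducedLE {P : Type*} [PartialOrder P] (pbar qbar : P)
    (p q : {x : P // x ≠ pbar ∧ x ≠ qbar}) : Prop :=
  p.1 ≤ q.1 ∨ (pbar ≤ q.1 ∧ p.1 ≤ qbar)

/-- Let `(P, ≼)` be a finite partially ordered set and `(p̄, q̄)` an adjacent pair in `P`
(that is, `p̄ ≼ q̄`, `p̄ ≠ q̄`, and `p̄ ≼ r ≼ q̄` implies `r ∈ {p̄, q̄}`).  Then the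
relation `≼'` defined on `P' := P ∖ {p̄, q̄}` by `p ≼' q` iff (`p ≼ q`) or
(`p̄ ≼ q` and `p ≼ q̄`) is a partial order on `P'`: reflexive, antisymmetric and
transitive. -/
theorem induced_relation_is_partial_order {P : Type*} [Fintype P] [PartialOrder P]
    (pbar qbar : P) (hle : pbar ≤ qbar) (hne : pbar ≠ qbar)
    (hadj : ∀ r : P, pbar ≤ r → r ≤ qbar → r = pbar ∨ r = qbar) :
    (∀ p, inducedLE pbar qbar p p) ∧
    (∀ p q, inducedLE pbar qbar p q → inducedLE pbar qbar q p → p = q) ∧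
    (∀ p q r, inducedLE pbar qbar p q → inducedLE pbar qbar q r →
      inducedLE pbar qbar p r) := by
  have between (r : {x : P // x ≠ pbar ∧ x ≠ qbar}) (h₁ : pbar ≤ r.1) (h₂ : r.1 ≤ qbar) :
      False :=
    (hadj r.1 h₁ h₂).elim r.2.1 r.2.2
  refine ⟨fun p => Or.inl le_rfl, ?_, ?_⟩
  · rintro p q (hpq | ⟨hq, hp⟩) (hqp | ⟨hp', hq'⟩)
    · exact Subtype.ext (le_antisymm hpq hqp)
    · exact (between p hp' (hpq.trans hq')).elim
    · exact (between q hq (hqp.trans hp)).elim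
    · exact (between q hq hq').elim
  · rintro p q r (hpq | ⟨hq, hp⟩) (hqr | ⟨hr, hq'⟩)
    · exact Or.inl (hpq.trans hqr)
    · exact Or.inr ⟨hr, hpq.trans hq'⟩
    · exact Or.inr ⟨hq.trans hqr, hp⟩
    · exact Or.inr ⟨hr, hp⟩
end
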